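/- Let n ≥ 1. There exists a group homomorphism θ_n : H̃_n → H_n sending each s_i to the transposition (i, i+1) (with trivial (Fin n → ZMod 2)-component), each a_j to the j-th standard basis vector of Fin n → ZMod 2 (with trivial permutation component), and z to the identity. Moreover θ_n is surjective, its kernel is the two-element central subgroup {1, z}, and in particular z ≠ 1 in H̃_n. -/

import Mathlib

/-!
STATEMENT 1: for `n ≥ 1` there is a group homomorphism
`θₙ : H̃ₙ → Hₙ = (Fin n → ZMod 2) ⋊ Perm (Fin n)` with the prescribed values on
generators; it is surjective with kernel the two-element central subgroup
`{1, z}`, and in particular `z ≠ 1` in `H̃ₙ`.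
(The additive group `Fin n → ZMod 2` is used multiplicatively, as
`Fin n → Multiplicative (ZMod 2)`.)
-/

namespace SpinHyperoctahedral

inductive HGen (n : ℕ) : Type
  | s : Fin (n - 1) → HGen n
  | a : Fin n → HGen n
  | z : HGen n

variable {n : ℕ}

def S (i : Fin (n - 1)) : FreeGroup (HGen n) := FreeGroup.of (HGen.s i)
def A (j : Fin n) : FreeGroup (HGen n) := FreeGroup.of (HGen.a j)
def Z : FreeGroup (HGen n) := FreeGroup.of (HGen.z)

def idx1 (i : Fin (n - 1)) : Fin n := ⟨(i : ℕ), by have := i.isLt; omega⟩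
def idx2 (i : Fin (n - 1)) : Fin n := ⟨(i : ℕ) + 1, by have := i.isLt; omega⟩

def hRels (n : ℕ) : Set (FreeGroup (HGen n)) :=
  { w | (∃ i : Fin (n - 1), w = Z * S i * Z⁻¹ * (S i)⁻¹)
    ∨ (∃ j : Fin n, w = Z * A j * Z⁻¹ * (A j)⁻¹)
    ∨ (w = Z ^ 2)
    ∨ (∃ i : Fin (n - 1), w = S i ^ 2)
    ∨ (∃ i j : Fin (n - 1), (j : ℕ) = (i : ℕ) + 1 ∧ w = (S i * S j) ^ 3)
    ∨ (∃ i j : Fin (n - 1), ((i : ℕ) + 2 ≤ (j : ℕ) ∨ (j : ℕ) + 2 ≤ (i : ℕ)) ∧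
        w = (S i * S j) ^ 2)
    ∨ (∃ i : Fin (n - 1), w = S i * A (idx1 i) * (S i)⁻¹ * (A (idx2 i))⁻¹)
    ∨ (∃ (i : Fin (n - 1)) (j : Fin n), (j : ℕ) ≠ (i : ℕ) ∧ (j : ℕ) ≠ (i : ℕ) + 1 ∧
        w = S i * A j * (S i)⁻¹ * (A j)⁻¹)
    ∨ (∃ j : Fin n, w = A j ^ 2 * Z⁻¹)
    ∨ (∃ i j : Fin n, i ≠ j ∧ w = A i * A j * (A i)⁻¹ * (A j)⁻¹ * Z⁻¹) }

abbrev HTilde (n : ℕ) := PresentedGroup (hRels n)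

/-- The action of `Perm (Fin n)` on `Fin n → M` by permuting the coordinates. -/
def permAut (n : ℕ) (M : Type*) [Group M] : Equiv.Perm (Fin n) →* MulAut (Fin n → M) where
  toFun σ := { Equiv.arrowCongr σ (Equiv.refl M) with map_mul' := fun _ _ => rfl }
  map_one' := rfl
  map_mul' := fun _ _ => rfl

/-- The hyperoctahedral group `Hₙ = (Fin n → ZMod 2) ⋊ Perm (Fin n)`,
with `ZMod 2` written multiplicatively. -/
abbrev HOcta (n : ℕ) :=
  SemidirectProduct (Fin n → Multiplicative (ZMod 2)) (Equiv.Perm (Fin n))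
    (permAut n (Multiplicative (ZMod 2)))

section Clifford

variable (n)

/-- The negative definite form `v ↦ -∑ i, v i ^ 2`. -/
def negSumSquares : QuadraticForm ℚ (Fin n → ℚ) :=
  QuadraticMap.weightedSumSquares ℚ fun _ : Fin n => (-1 : ℚ)

variable {n}

lemma negSumSquares_apply (v : Fin n → ℚ) : negSumSquares n v = ∑ i, -(v i * v i) := by
  simp [negSumSquares, QuadraticMap.weightedSumSquares_apply]

/-- Permutations of coordinates as isometries of `negSumSquares`. -/
def permIsometry (σ : Equiv.Perm (Fin n)) : (negSumSquares n).IsometryEquiv (negSumSquares n) where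
  toLinearEquiv := LinearEquiv.funCongrLeft ℚ ℚ σ.symm
  map_app' v := by
    change negSumSquares n (fun i => v (σ.symm i)) = _
    simp only [negSumSquares_apply]
    exact Equiv.sum_comp σ.symm fun i => -(v i * v i)

/-- Permutations of coordinates acting on the units of the Clifford algebra. -/
def permCliffordUnits : Equiv.Perm (Fin n) →* MulAut (CliffordAlgebra (negSumSquares n))ˣ where
  toFun σ := Units.mapEquiv (CliffordAlgebra.equivOfIsometry (permIsometry σ)).toMulEquiv
  map_one' := by
    ext u
    exact AlgEquiv.congr_fun
      (CliffordAlgebra.equivOfIsometry_refl (Q₁ := negSumSquares n)) (u : CliffordAlgebra _)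
  map_mul' σ τ := by
    ext u
    exact (AlgEquiv.congr_fun
      (CliffordAlgebra.equivOfIsometry_trans (permIsometry τ) (permIsometry σ))
      (u : CliffordAlgebra _)).symm

lemma ι_single_mul_self (j : Fin n) :
    CliffordAlgebra.ι (negSumSquares n) (Pi.single j 1) *
      CliffordAlgebra.ι (negSumSquares n) (Pi.single j 1) = -1 := by
  rw [CliffordAlgebra.ι_sq_scalar, negSumSquares_apply]
  simp [Pi.single_apply]

/-- The basis vectors as units of the Clifford algebra. -/
def cliffordUnit (j : Fin n) : (CliffordAlgebra (negSumSquares n))ˣ where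
  val := CliffordAlgebra.ι _ (Pi.single j 1)
  inv := -CliffordAlgebra.ι _ (Pi.single j 1)
  val_inv := by rw [mul_neg, ι_single_mul_self, neg_neg]
  inv_val := by rw [neg_mul, ι_single_mul_self, neg_neg]

lemma cliffordUnit_mul_self (j : Fin n) : cliffordUnit j * cliffordUnit j = -1 :=
  Units.ext (ι_single_mul_self j)

lemma cliffordUnit_anticomm {i j : Fin n} (hij : i ≠ j) :
    cliffordUnit i * cliffordUnit j = -1 * (cliffordUnit j * cliffordUnit i) := by
  refine Units.ext ?_
  simp only [Units.val_mul, Units.val_neg, neg_mul, one_mul]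
  refine CliffordAlgebra.ι_mul_ι_comm_of_isOrtho ?_
  rw [QuadraticMap.isOrtho_def]
  simp only [negSumSquares_apply, ← Finset.sum_add_distrib]
  refine Finset.sum_congr rfl fun k _ => ?_
  by_cases hi : k = i
  · subst hi; simp [hij]
  · simp [hi]

lemma permCliffordUnits_cliffordUnit (σ : Equiv.Perm (Fin n)) (j : Fin n) :
    permCliffordUnits σ (cliffordUnit j) = cliffordUnit (σ j) := by
  refine Units.ext ?_
  refine (CliffordAlgebra.map_apply_ι (permIsometry σ).toIsometry (Pi.single j 1)).trans ?_
  refine congrArg (CliffordAlgebra.ι _) ?_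
  ext i
  change (Pi.single j (1 : ℚ) : Fin n → ℚ) (σ.symm i) = _
  simp [Pi.single_apply, Equiv.symm_apply_eq]

lemma neg_one_ne_one_cliffordUnits : (-1 : (CliffordAlgebra (negSumSquares n))ˣ) ≠ 1 := by
  have : Invertible (2 : ℚ) := invertibleOfNonzero two_ne_zero
  have : CharZero (CliffordAlgebra (negSumSquares n)) := algebraRat.charZero _
  intro h
  have h' : (-1 : CliffordAlgebra (negSumSquares n)) = 1 := by
    simpa using congrArg Units.val h
  rw [neg_eq_iff_add_eq_zero, one_add_one_eq_two] at h'
  exact two_ne_zero h'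

end Clifford

section Lift

lemma swap_idx_pow_two (i : Fin (n - 1)) :
    (Equiv.swap (idx1 i) (idx2 i)) ^ 2 = 1 := by
  rw [sq, Equiv.swap_mul_self]

lemma swap_idx_mul_pow_three {i j : Fin (n - 1)} (h : (j : ℕ) = i + 1) :
    (Equiv.swap (idx1 i) (idx2 i) * Equiv.swap (idx1 j) (idx2 j)) ^ 3 = 1 := by
  have hij : idx2 i = idx1 j := Fin.ext h.symm
  rw [hij, Equiv.swap_comm (idx1 i)]
  have h1 : idx1 j ≠ idx1 i := fun e => by simp [idx1, Fin.ext_iff] at e; omega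
  have h2 : idx1 j ≠ idx2 j := fun e => by simp [idx1, idx2, Fin.ext_iff] at e
  have h3 : idx1 i ≠ idx2 j := fun e => by simp [idx1, idx2, Fin.ext_iff] at e; omega
  have := (Equiv.Perm.isThreeCycle_swap_mul_swap_same h1 h2 h3).orderOf
  rw [← this, pow_orderOf_eq_one]

lemma swap_idx_mul_pow_two {i j : Fin (n - 1)} (h : (i : ℕ) + 2 ≤ j ∨ (j : ℕ) + 2 ≤ i) :
    (Equiv.swap (idx1 i) (idx2 i) * Equiv.swap (idx1 j) (idx2 j)) ^ 2 = 1 := by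
  have hc : Commute (Equiv.swap (idx1 i) (idx2 i)) (Equiv.swap (idx1 j) (idx2 j)) := by
    refine (Equiv.Perm.disjoint_swap_swap ?_).commute
    simp [idx1, idx2, Fin.ext_iff]
    omega
  rw [hc.mul_pow, swap_idx_pow_two, swap_idx_pow_two, one_mul]

/-- A homomorphism out of `H̃ₙ` into a semidirect product by the symmetric group. -/
lemma exists_hom_semidirectProduct {N : Type*} [Group N] (φ : Equiv.Perm (Fin n) →* MulAut N)
    (a : Fin n → N) (ζ : N) (hφa : ∀ σ j, φ σ (a j) = a (σ j)) (hφζ : ∀ σ, φ σ ζ = ζ)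
    (hζ : ζ ^ 2 = 1) (hζa : ∀ j, ζ * a j = a j * ζ) (ha : ∀ j, a j * a j = ζ)
    (haa : ∀ i j, i ≠ j → a i * a j = ζ * (a j * a i)) :
    ∃ f : HTilde n →* SemidirectProduct N (Equiv.Perm (Fin n)) φ,
      (∀ i : Fin (n - 1), f (PresentedGroup.of (HGen.s i)) =
        SemidirectProduct.inr (Equiv.swap (idx1 i) (idx2 i))) ∧
      (∀ j, f (PresentedGroup.of (HGen.a j)) = SemidirectProduct.inl (a j)) ∧
      f (PresentedGroup.of HGen.z) = SemidirectProduct.inl ζ := by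
  let g : HGen n → SemidirectProduct N (Equiv.Perm (Fin n)) φ
    | HGen.s i => SemidirectProduct.inr (Equiv.swap (idx1 i) (idx2 i))
    | HGen.a j => SemidirectProduct.inl (a j)
    | HGen.z => SemidirectProduct.inl ζ
  have hS (i : Fin (n - 1)) : FreeGroup.lift g (S i) =
      SemidirectProduct.inr (Equiv.swap (idx1 i) (idx2 i)) := by simp [S, g]
  have hA (j : Fin n) : FreeGroup.lift g (A j) = SemidirectProduct.inl (a j) := by simp [A, g]
  have hZ : FreeGroup.lift g Z = SemidirectProduct.inl ζ := by simp [Z, g]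
  have hg : ∀ r ∈ hRels n, FreeGroup.lift g r = 1 := by
    rintro r (⟨i, rfl⟩ | ⟨j, rfl⟩ | rfl | ⟨i, rfl⟩ | ⟨i, j, h, rfl⟩ | ⟨i, j, h, rfl⟩ | ⟨i, rfl⟩ |
      ⟨i, j, h, h', rfl⟩ | ⟨j, rfl⟩ | ⟨i, j, h, rfl⟩) <;>
      simp only [map_mul, map_inv, map_pow, hS, hA, hZ]
    · rw [mul_inv_eq_one, mul_inv_eq_iff_eq_mul]
      ext <;> simp [hφζ]
    · rw [mul_inv_eq_one, mul_inv_eq_iff_eq_mul, ← map_mul, hζa, map_mul]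
    · rw [← map_pow, hζ, map_one]
    · rw [← map_pow, swap_idx_pow_two, map_one]
    · rw [← map_mul, ← map_pow, swap_idx_mul_pow_three h, map_one]
    · rw [← map_mul, ← map_pow, swap_idx_mul_pow_two h, map_one]
    · rw [← map_inv SemidirectProduct.inr, ← SemidirectProduct.inl_aut, hφa,
        Equiv.swap_apply_left, mul_inv_cancel]
    · rw [← map_inv SemidirectProduct.inr, ← SemidirectProduct.inl_aut, hφa,
        Equiv.swap_apply_of_ne_of_ne, mul_inv_cancel]
      · exact fun e => h (congrArg Fin.val e)
      · exact fun e => h' (congrArg Fin.val e)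
    · rw [sq, ← map_mul, ha, mul_inv_cancel]
    · rw [mul_inv_eq_one, mul_inv_eq_iff_eq_mul, mul_inv_eq_iff_eq_mul]
      simp only [← map_mul]
      rw [haa i j h, mul_assoc]
  exact ⟨PresentedGroup.toGroup hg, fun i => PresentedGroup.toGroup.of hg,
    fun j => PresentedGroup.toGroup.of hg, PresentedGroup.toGroup.of hg⟩

end Lift

section Coxeter

variable {G : Type*} [Group G]

/-- The product `s j * s (j + 1) * ⋯ * s (j + d - 1)`. -/
def consecutiveProd (s : ℕ → G) : ℕ → ℕ → G
  | _, 0 => 1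
  | j, d + 1 => s j * consecutiveProd s (j + 1) d

lemma mul_consecutiveProd_of_lt {s : ℕ → G} {m : ℕ}
    (comm : ∀ i j, i + 2 ≤ j → j < m → s i * s j = s j * s i) (i : ℕ) (d : ℕ) :
    ∀ j, i + 2 ≤ j → j + d ≤ m →
      s i * consecutiveProd s j d = consecutiveProd s j d * s i := by
  induction d with
  | zero => intro j _ _; simp [consecutiveProd]
  | succ d ih =>
    intro j hj hd
    rw [consecutiveProd, ← mul_assoc, comm i j hj (by omega), mul_assoc,
      ih (j + 1) (by omega) (by omega), mul_assoc]

lemma succ_mul_consecutiveProd {s : ℕ → G} {m : ℕ}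
    (braid : ∀ i, i + 1 < m → s i * s (i + 1) * s i = s (i + 1) * s i * s (i + 1))
    (comm : ∀ i j, i + 2 ≤ j → j < m → s i * s j = s j * s i) (i : ℕ) (d : ℕ) :
    ∀ j, j ≤ i → i + 1 < j + d → j + d ≤ m →
      s (i + 1) * consecutiveProd s j d = consecutiveProd s j d * s i := by
  induction d with
  | zero => intro j _ _ _; omega
  | succ d ih =>
    intro j hji hid hd
    rcases hji.eq_or_lt with rfl | hlt
    · obtain ⟨e, rfl⟩ : ∃ e, d = e + 1 := ⟨d - 1, by omega⟩
      simp only [consecutiveProd]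
      calc s (j + 1) * (s j * (s (j + 1) * consecutiveProd s (j + 1 + 1) e))
          = s (j + 1) * s j * s (j + 1) * consecutiveProd s (j + 1 + 1) e := by group
        _ = s j * s (j + 1) * (s j * consecutiveProd s (j + 1 + 1) e) := by
          rw [← braid j (by omega)]; group
        _ = _ := by
          rw [mul_consecutiveProd_of_lt comm j e (j + 1 + 1) le_rfl (by omega)]; group
    · rw [consecutiveProd, ← mul_assoc, ← comm j (i + 1) (by omega) (by omega), mul_assoc,
        ih (j + 1) hlt (by omega) (by omega), mul_assoc]

/-- Left coset representatives for one step of the Coxeter tower of type `A`, over a normal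
subgroup `N`. -/
lemma exists_eq_consecutiveProd_mul {s : ℕ → G} {m : ℕ} {N : Subgroup G} [N.Normal]
    (hsq : ∀ i, i < m + 1 → s i * s i = 1)
    (braid : ∀ i, i + 1 < m + 1 → s i * s (i + 1) * s i = s (i + 1) * s i * s (i + 1))
    (comm : ∀ i j, i + 2 ≤ j → j < m + 1 → s i * s j = s j * s i) {g : G}
    (hg : g ∈ Subgroup.closure ((N : Set G) ∪ s '' Set.Iio (m + 1))) :
    ∃ j d, j + d = m + 1 ∧ ∃ h ∈ Subgroup.closure ((N : Set G) ∪ s '' Set.Iio m),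
      g = consecutiveProd s j d * h := by
  set L := Subgroup.closure ((N : Set G) ∪ s '' Set.Iio m) with hL
  have hNL {x : G} (hx : x ∈ N) : x ∈ L := Subgroup.subset_closure (Or.inl hx)
  have hsL {i : ℕ} (hi : i < m) : s i ∈ L := Subgroup.subset_closure (Or.inr ⟨i, hi, rfl⟩)
  have hN : ∀ x ∈ N, ∀ y, (∃ j d, j + d = m + 1 ∧ ∃ h ∈ L, y = consecutiveProd s j d * h) →
      ∃ j d, j + d = m + 1 ∧ ∃ h ∈ L, x * y = consecutiveProd s j d * h := by
    rintro x hx _ ⟨j, d, hjd, h, hh, rfl⟩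
    refine ⟨j, d, hjd, (consecutiveProd s j d)⁻¹ * x * consecutiveProd s j d * h,
      mul_mem (hNL ?_) hh, by group⟩
    simpa using ‹N.Normal›.conj_mem x hx (consecutiveProd s j d)⁻¹
  have hs : ∀ i < m + 1, ∀ y, (∃ j d, j + d = m + 1 ∧ ∃ h ∈ L, y = consecutiveProd s j d * h) →
      ∃ j d, j + d = m + 1 ∧ ∃ h ∈ L, s i * y = consecutiveProd s j d * h := by
    rintro i hi _ ⟨j, d, hjd, h, hh, rfl⟩
    rcases lt_trichotomy i j with hij | rfl | hij
    · rcases (Nat.succ_le_of_lt hij).eq_or_lt with rfl | hlt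
      · exact ⟨i, d + 1, by omega, h, hh, by rw [consecutiveProd, mul_assoc]⟩
      · refine ⟨j, d, hjd, s i * h, mul_mem (hsL (by omega)) hh, ?_⟩
        rw [← mul_assoc, mul_consecutiveProd_of_lt comm i d j hlt hjd.le, mul_assoc]
    · obtain ⟨e, rfl⟩ : ∃ e, d = e + 1 := ⟨d - 1, by omega⟩
      refine ⟨i + 1, e, by omega, h, hh, ?_⟩
      rw [consecutiveProd, ← mul_assoc, ← mul_assoc, hsq i hi, one_mul]
    · obtain ⟨k, rfl⟩ : ∃ k, i = k + 1 := ⟨i - 1, by omega⟩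
      refine ⟨j, d, hjd, s k * h, mul_mem (hsL (by omega)) hh, ?_⟩
      rw [← mul_assoc, succ_mul_consecutiveProd braid comm k d j (by omega) (by omega) hjd.le,
        mul_assoc]
  induction hg using Subgroup.closure_induction_left with
  | one => exact ⟨m + 1, 0, rfl, 1, one_mem _, by simp [consecutiveProd]⟩
  | mul_left x hx y _ ih =>
    rcases hx with hx | ⟨i, hi, rfl⟩
    · exact hN x hx y ih
    · exact hs i hi y ih
  | inv_mul_cancel x hx y _ ih =>
    rcases hx with hx | ⟨i, hi, rfl⟩
    · exact hN x⁻¹ (inv_mem hx) y ih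
    · rw [inv_eq_of_mul_eq_one_left (hsq i hi)]
      exact hs i hi y ih

variable {X : Type*} [DecidableEq X]

lemma perm_consecutiveProd_apply {s : ℕ → G} {m : ℕ} {p : ℕ → X} {φ : G →* Equiv.Perm X}
    (hφs : ∀ i < m, φ (s i) = Equiv.swap (p i) (p (i + 1))) (d : ℕ) :
    ∀ j, j + d ≤ m → φ (consecutiveProd s j d) (p (j + d)) = p j := by
  induction d with
  | zero => intro j _; simp [consecutiveProd]
  | succ d ih =>
    intro j hj
    have := ih (j + 1) (by omega)
    rw [consecutiveProd, map_mul, Equiv.Perm.mul_apply, show j + (d + 1) = j + 1 + d by omega,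
      this, hφs j (by omega), Equiv.swap_apply_right]

/-- Faithfulness of the Coxeter presentation of the symmetric group, relative to a normal
subgroup acting trivially. -/
theorem mem_of_perm_eq_one {s : ℕ → G} {N : Subgroup G} [N.Normal] {p : ℕ → X}
    {φ : G →* Equiv.Perm X} (hφN : ∀ x ∈ N, φ x = 1) (m : ℕ) (hp : Set.InjOn p (Set.Iic m))
    (hsq : ∀ i < m, s i * s i = 1)
    (braid : ∀ i, i + 1 < m → s i * s (i + 1) * s i = s (i + 1) * s i * s (i + 1))
    (comm : ∀ i j, i + 2 ≤ j → j < m → s i * s j = s j * s i)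
    (hφs : ∀ i < m, φ (s i) = Equiv.swap (p i) (p (i + 1)))
    {g : G} (hg : g ∈ Subgroup.closure ((N : Set G) ∪ s '' Set.Iio m)) (h1 : φ g = 1) :
    g ∈ N := by
  induction m generalizing g with
  | zero => simpa using hg
  | succ m ih =>
    obtain ⟨j, d, hjd, h, hh, rfl⟩ := exists_eq_consecutiveProd_mul hsq braid comm hg
    have hfix : φ h (p (m + 1)) = p (m + 1) := by
      have hle : Subgroup.closure ((N : Set G) ∪ s '' Set.Iio m) ≤
          (MulAction.stabilizer (Equiv.Perm X) (p (m + 1))).comap φ := by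
        rw [Subgroup.closure_le]
        rintro x (hx | ⟨i, hi, rfl⟩)
        · simp [hφN x hx]
        · have hi' : i < m := hi
          simp only [Subgroup.coe_comap, Set.mem_preimage, SetLike.mem_coe,
            MulAction.mem_stabilizer_iff, Equiv.Perm.smul_def, hφs i (by omega)]
          refine Equiv.swap_apply_of_ne_of_ne ?_ ?_
          · exact fun e => by have := hp (by simp) (by simp; omega) e; omega
          · exact fun e => by have := hp (by simp) (by simp; omega) e; omega
      exact hle hh
    have hj : p j = p (m + 1) := by
      rw [← perm_consecutiveProd_apply hφs d j hjd.le, hjd]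
      conv_lhs => rw [← hfix]
      rw [← Equiv.Perm.mul_apply, ← map_mul, h1, Equiv.Perm.one_apply]
    have hj' : j = m + 1 := hp (by simp; omega) (by simp) hj
    obtain rfl : d = 0 := by omega
    rw [consecutiveProd, one_mul] at h1 ⊢
    exact ih (hp.mono (Set.Iic_subset_Iic.2 m.le_succ)) (fun i hi => hsq i (by omega))
      (fun i hi => braid i (by omega)) (fun i j hij hj => comm i j hij (by omega))
      (fun i hi => hφs i (by omega)) hh h1

end Coxeter

section Relations

/-- The generator `s i` of `H̃ₙ`. -/
abbrev sGen (i : Fin (n - 1)) : HTilde n := PresentedGroup.of (HGen.s i)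

/-- The generator `a j` of `H̃ₙ`. -/
abbrev aGen (j : Fin n) : HTilde n := PresentedGroup.of (HGen.a j)

variable (n) in
/-- The generator `z` of `H̃ₙ`. -/
abbrev zGen : HTilde n := PresentedGroup.of HGen.z

lemma zGen_mul_sGen (i : Fin (n - 1)) : zGen n * sGen i = sGen i * zGen n := by
  have h : Z * S i * Z⁻¹ * (S i)⁻¹ ∈ hRels n := Or.inl ⟨i, rfl⟩
  have h := PresentedGroup.one_of_mem h
  simp only [map_mul, map_inv] at h
  exact mul_inv_eq_iff_eq_mul.1 (mul_inv_eq_one.1 h)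

lemma zGen_mul_aGen (j : Fin n) : zGen n * aGen j = aGen j * zGen n := by
  have h : Z * A j * Z⁻¹ * (A j)⁻¹ ∈ hRels n := Or.inr (Or.inl ⟨j, rfl⟩)
  have h := PresentedGroup.one_of_mem h
  simp only [map_mul, map_inv] at h
  exact mul_inv_eq_iff_eq_mul.1 (mul_inv_eq_one.1 h)

lemma zGen_mul_self : zGen n * zGen n = 1 := by
  have h : Z ^ 2 ∈ hRels n := Or.inr (Or.inr (Or.inl rfl))
  have h := PresentedGroup.one_of_mem h
  rw [sq, map_mul] at h
  exact h

lemma sGen_mul_self (i : Fin (n - 1)) : sGen i * sGen i = 1 := by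
  have h : S i ^ 2 ∈ hRels n := Or.inr (Or.inr (Or.inr (Or.inl ⟨i, rfl⟩)))
  have h := PresentedGroup.one_of_mem h
  rw [sq, map_mul] at h
  exact h

lemma sGen_inv (i : Fin (n - 1)) : (sGen i)⁻¹ = sGen i :=
  inv_eq_of_mul_eq_one_left (sGen_mul_self i)

lemma sGen_braid {i j : Fin (n - 1)} (hij : (j : ℕ) = i + 1) :
    sGen i * sGen j * sGen i = sGen j * sGen i * sGen j := by
  have h : (S i * S j) ^ 3 ∈ hRels n :=
    Or.inr (Or.inr (Or.inr (Or.inr (Or.inl ⟨i, j, hij, rfl⟩))))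
  have h := PresentedGroup.one_of_mem h
  rw [map_pow, map_mul] at h
  replace h : sGen i * sGen j * sGen i * (sGen j * sGen i * sGen j) = 1 := by
    rw [← h, pow_three]
    simp only [mul_assoc]
    rfl
  rw [eq_inv_of_mul_eq_one_left h]
  simp only [mul_inv_rev, sGen_inv, mul_assoc]

lemma sGen_comm {i j : Fin (n - 1)} (hij : (i : ℕ) + 2 ≤ j) :
    sGen i * sGen j = sGen j * sGen i := by
  have h : (S i * S j) ^ 2 ∈ hRels n :=
    Or.inr (Or.inr (Or.inr (Or.inr (Or.inr (Or.inl ⟨i, j, Or.inl hij, rfl⟩)))))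
  have h := PresentedGroup.one_of_mem h
  rw [map_pow, map_mul, sq] at h
  have h' : sGen i * sGen j = (sGen i * sGen j)⁻¹ := eq_inv_of_mul_eq_one_left h
  rw [h', mul_inv_rev, sGen_inv, sGen_inv]

lemma sGen_conj_aGen_idx1 (i : Fin (n - 1)) :
    sGen i * aGen (idx1 i) * (sGen i)⁻¹ = aGen (idx2 i) := by
  have h : S i * A (idx1 i) * (S i)⁻¹ * (A (idx2 i))⁻¹ ∈ hRels n :=
    Or.inr (Or.inr (Or.inr (Or.inr (Or.inr (Or.inr (Or.inl ⟨i, rfl⟩))))))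
  have h := PresentedGroup.one_of_mem h
  simp only [map_mul, map_inv] at h
  exact mul_inv_eq_one.1 h

lemma sGen_conj_aGen_idx2 (i : Fin (n - 1)) :
    sGen i * aGen (idx2 i) * (sGen i)⁻¹ = aGen (idx1 i) := by
  rw [← sGen_conj_aGen_idx1, ← mul_assoc, ← mul_assoc, sGen_mul_self, one_mul, mul_assoc,
    ← mul_inv_rev, sGen_mul_self, inv_one, mul_one]

lemma sGen_conj_aGen_of_ne {i : Fin (n - 1)} {j : Fin n} (h1 : j ≠ idx1 i) (h2 : j ≠ idx2 i) :
    sGen i * aGen j * (sGen i)⁻¹ = aGen j := by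
  have h : S i * A j * (S i)⁻¹ * (A j)⁻¹ ∈ hRels n :=
    Or.inr (Or.inr (Or.inr (Or.inr (Or.inr (Or.inr (Or.inr (Or.inl
      ⟨i, j, fun e => h1 (Fin.ext e), fun e => h2 (Fin.ext e), rfl⟩)))))))
  have h := PresentedGroup.one_of_mem h
  simp only [map_mul, map_inv] at h
  exact mul_inv_eq_one.1 h

lemma aGen_mul_self (j : Fin n) : aGen j * aGen j = zGen n := by
  have h : A j ^ 2 * Z⁻¹ ∈ hRels n :=
    Or.inr (Or.inr (Or.inr (Or.inr (Or.inr (Or.inr (Or.inr (Or.inr (Or.inl ⟨j, rfl⟩))))))))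
  have h := PresentedGroup.one_of_mem h
  simp only [sq, map_mul, map_inv] at h
  exact mul_inv_eq_one.1 h

lemma aGen_anticomm {i j : Fin n} (hij : i ≠ j) :
    aGen i * aGen j = zGen n * (aGen j * aGen i) := by
  have h : A i * A j * (A i)⁻¹ * (A j)⁻¹ * Z⁻¹ ∈ hRels n :=
    Or.inr (Or.inr (Or.inr (Or.inr (Or.inr (Or.inr (Or.inr (Or.inr (Or.inr ⟨i, j, hij, rfl⟩))))))))
  have h := PresentedGroup.one_of_mem h
  simp only [map_mul, map_inv] at h
  have h' := mul_inv_eq_iff_eq_mul.1 (mul_inv_eq_iff_eq_mul.1 (mul_inv_eq_one.1 h))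
  exact h'.trans (mul_assoc _ _ _)

lemma aGen_inv (j : Fin n) : (aGen j)⁻¹ = aGen j * zGen n := by
  refine inv_eq_of_mul_eq_one_right ?_
  rw [← mul_assoc, aGen_mul_self, zGen_mul_self]

lemma zGen_inv : (zGen n)⁻¹ = zGen n := inv_eq_of_mul_eq_one_left zGen_mul_self

lemma zGen_mem_center : zGen n ∈ Subgroup.center (HTilde n) := by
  have hle : ∀ g, g ∈ Subgroup.centralizer {zGen n} := by
    refine PresentedGroup.generated_by _ _ ?_
    rintro (i | j | _) <;> rw [Subgroup.mem_centralizer_singleton_iff]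
    · exact (zGen_mul_sGen i).symm
    · exact (zGen_mul_aGen j).symm
  exact Subgroup.mem_center_iff.2 fun g => Subgroup.mem_centralizer_singleton_iff.1 (hle g)

lemma zGen_mul_comm (g : HTilde n) : zGen n * g = g * zGen n :=
  (Subgroup.mem_center_iff.1 zGen_mem_center g).symm

end Relations

section Kernel

/-- The subgroup generated by `z` and the `a j` with `j ∈ F`. -/
def aSubgroup (F : Set (Fin n)) : Subgroup (HTilde n) :=
  Subgroup.closure (insert (zGen n) (aGen '' F))

lemma zGen_mem_aSubgroup (F : Set (Fin n)) : zGen n ∈ aSubgroup F :=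
  Subgroup.subset_closure (Set.mem_insert _ _)

lemma aGen_mem_aSubgroup {F : Set (Fin n)} {j : Fin n} (hj : j ∈ F) : aGen j ∈ aSubgroup F :=
  Subgroup.subset_closure (Set.mem_insert_of_mem _ ⟨j, hj, rfl⟩)

lemma eq_one_or_zGen_of_mem_aSubgroup_empty {t : HTilde n} (ht : t ∈ aSubgroup (∅ : Set (Fin n))) :
    t = 1 ∨ t = zGen n := by
  rw [aSubgroup, Set.image_empty] at ht
  induction ht using Subgroup.closure_induction_left with
  | one => exact Or.inl rfl
  | mul_left x hx y _ ih =>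
    obtain rfl : x = zGen n := by simpa using hx
    rcases ih with rfl | rfl
    · exact Or.inr (mul_one _)
    · exact Or.inl zGen_mul_self
  | inv_mul_cancel x hx y _ ih =>
    obtain rfl : x = zGen n := by simpa using hx
    rw [zGen_inv]
    rcases ih with rfl | rfl
    · exact Or.inr (mul_one _)
    · exact Or.inl zGen_mul_self

lemma mem_aSubgroup_insert {F : Set (Fin n)} {k : Fin n} (hk : k ∉ F) {g : HTilde n}
    (hg : g ∈ aSubgroup (insert k F)) :
    g ∈ aSubgroup F ∨ ∃ t ∈ aSubgroup F, g = aGen k * t := by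
  have hz : ∀ y : HTilde n, (y ∈ aSubgroup F ∨ ∃ t ∈ aSubgroup F, y = aGen k * t) →
      (zGen n * y ∈ aSubgroup F ∨ ∃ t ∈ aSubgroup F, zGen n * y = aGen k * t) := by
    rintro y (hy | ⟨t, ht, rfl⟩)
    · exact Or.inl (mul_mem (zGen_mem_aSubgroup F) hy)
    · refine Or.inr ⟨zGen n * t, mul_mem (zGen_mem_aSubgroup F) ht, ?_⟩
      rw [← mul_assoc, zGen_mul_comm, mul_assoc]
  have ha : ∀ j ∈ insert k F, ∀ y : HTilde n,
      (y ∈ aSubgroup F ∨ ∃ t ∈ aSubgroup F, y = aGen k * t) →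
      (aGen j * y ∈ aSubgroup F ∨ ∃ t ∈ aSubgroup F, aGen j * y = aGen k * t) := by
    rintro j (rfl | hj) y (hy | ⟨t, ht, rfl⟩)
    · exact Or.inr ⟨y, hy, rfl⟩
    · rw [← mul_assoc, aGen_mul_self]
      exact Or.inl (mul_mem (zGen_mem_aSubgroup F) ht)
    · exact Or.inl (mul_mem (aGen_mem_aSubgroup hj) hy)
    · refine Or.inr ⟨zGen n * (aGen j * t),
        mul_mem (zGen_mem_aSubgroup F) (mul_mem (aGen_mem_aSubgroup hj) ht), ?_⟩
      have hjk : j ≠ k := by rintro rfl; exact hk hj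
      rw [← mul_assoc, aGen_anticomm hjk, ← mul_assoc (aGen k),
        ← zGen_mul_comm (aGen k)]
      simp only [mul_assoc]
  rw [aSubgroup] at hg
  induction hg using Subgroup.closure_induction_left with
  | one => exact Or.inl (one_mem _)
  | mul_left x hx y _ ih =>
    rcases hx with rfl | ⟨j, hj, rfl⟩
    · exact hz y ih
    · exact ha j hj y ih
  | inv_mul_cancel x hx y _ ih =>
    rcases hx with rfl | ⟨j, hj, rfl⟩
    · rw [zGen_inv]
      exact hz y ih
    · rw [aGen_inv, mul_assoc]
      exact ha j hj _ (hz y ih)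

instance aSubgroup_univ_normal : (aSubgroup (Set.univ : Set (Fin n))).Normal := by
  have hs (i : Fin (n - 1)) : ∀ h ∈ aSubgroup (Set.univ : Set (Fin n)),
      sGen i * h * (sGen i)⁻¹ ∈ aSubgroup Set.univ := by
    intro h hh
    refine (Subgroup.closure_le ((aSubgroup Set.univ).comap
      (MulAut.conj (sGen i)).toMonoidHom)).2 ?_ hh
    rintro x (rfl | ⟨j, -, rfl⟩)
    · change sGen i * zGen n * (sGen i)⁻¹ ∈ aSubgroup Set.univ
      rw [← zGen_mul_comm, mul_inv_cancel_right]
      exact zGen_mem_aSubgroup _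
    · change sGen i * aGen j * (sGen i)⁻¹ ∈ aSubgroup Set.univ
      by_cases h1 : j = idx1 i
      · rw [h1, sGen_conj_aGen_idx1]
        exact aGen_mem_aSubgroup trivial
      by_cases h2 : j = idx2 i
      · rw [h2, sGen_conj_aGen_idx2]
        exact aGen_mem_aSubgroup trivial
      rw [sGen_conj_aGen_of_ne h1 h2]
      exact aGen_mem_aSubgroup trivial
  rw [← Subgroup.normalizer_eq_top_iff, eq_top_iff]
  intro g _
  refine PresentedGroup.generated_by _ _ ?_ g
  rintro (i | j | _)
  · rw [Subgroup.mem_normalizer_iff]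
    refine fun h => ⟨hs i h, fun hh => ?_⟩
    have := hs i _ hh
    rw [sGen_inv] at this
    simpa only [mul_assoc, sGen_mul_self, mul_one, ← mul_assoc (sGen i) (sGen i) h, one_mul]
      using this
  · exact Subgroup.le_normalizer (aGen_mem_aSubgroup trivial)
  · exact Subgroup.le_normalizer (zGen_mem_aSubgroup _)

variable {θ : HTilde n →* HOcta n}

lemma exists_inl_of_mem_aSubgroup
    (hθa : ∀ j, θ (aGen j) =
      SemidirectProduct.inl (Pi.mulSingle j (Multiplicative.ofAdd (1 : ZMod 2))))
    (hθz : θ (zGen n) = 1) {F : Set (Fin n)} {t : HTilde n} (ht : t ∈ aSubgroup F) :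
    ∃ v : Fin n → Multiplicative (ZMod 2), θ t = SemidirectProduct.inl v ∧ ∀ k ∉ F, v k = 1 := by
  rw [aSubgroup] at ht
  induction ht using Subgroup.closure_induction with
  | mem x hx =>
    rcases hx with rfl | ⟨j, hj, rfl⟩
    · exact ⟨1, by rw [hθz, map_one], fun _ _ => rfl⟩
    · exact ⟨_, hθa j, fun k hk => Pi.mulSingle_eq_of_ne (by rintro rfl; exact hk hj) _⟩
  | one => exact ⟨1, by rw [map_one, map_one], fun _ _ => rfl⟩
  | mul x y _ _ hx hy =>
    obtain ⟨v, hv, hv'⟩ := hx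
    obtain ⟨w, hw, hw'⟩ := hy
    exact ⟨v * w, by rw [map_mul, hv, hw, map_mul], fun k hk => by
      rw [Pi.mul_apply, hv' k hk, hw' k hk, one_mul]⟩
  | inv x _ hx =>
    obtain ⟨v, hv, hv'⟩ := hx
    exact ⟨v⁻¹, by rw [map_inv, hv, map_inv], fun k hk => by rw [Pi.inv_apply, hv' k hk, inv_one]⟩

lemma eq_one_or_zGen_of_mem_aSubgroup
    (hθa : ∀ j, θ (aGen j) =
      SemidirectProduct.inl (Pi.mulSingle j (Multiplicative.ofAdd (1 : ZMod 2))))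
    (hθz : θ (zGen n) = 1) {F : Set (Fin n)} {t : HTilde n} (ht : t ∈ aSubgroup F)
    (h1 : θ t = 1) : t = 1 ∨ t = zGen n := by
  induction F, F.toFinite using Set.Finite.induction_on with
  | empty => exact eq_one_or_zGen_of_mem_aSubgroup_empty ht
  | @insert k F hk _ ih =>
    rcases mem_aSubgroup_insert hk ht with ht | ⟨u, hu, rfl⟩
    · exact ih ht
    · obtain ⟨v, hv, hv'⟩ := exists_inl_of_mem_aSubgroup hθa hθz hu
      rw [map_mul, hθa, hv, ← map_mul] at h1
      have h := congrFun (congrArg SemidirectProduct.left h1) k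
      simp only [SemidirectProduct.left_inl, SemidirectProduct.one_left, Pi.mul_apply,
        Pi.one_apply, Pi.mulSingle_eq_same, hv' k hk, mul_one] at h
      exact absurd h (show Multiplicative.ofAdd (1 : ZMod 2) ≠ 1 by decide)

/-- The generators `s i` of `H̃ₙ`, extended by `1` to a sequence. -/
def sSeq (n i : ℕ) : HTilde n := if h : i < n - 1 then sGen ⟨i, h⟩ else 1

lemma sSeq_of_lt {i : ℕ} (h : i < n - 1) : sSeq n i = sGen ⟨i, h⟩ := dif_pos h

lemma mem_closure_aSubgroup_sSeq (g : HTilde n) :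
    g ∈ Subgroup.closure
      ((aSubgroup (Set.univ : Set (Fin n)) : Set (HTilde n)) ∪ sSeq n '' Set.Iio (n - 1)) := by
  refine PresentedGroup.generated_by _ _ ?_ g
  rintro (i | j | _) <;> apply Subgroup.subset_closure
  · exact Or.inr ⟨i, i.isLt, sSeq_of_lt i.isLt⟩
  · exact Or.inl (aGen_mem_aSubgroup trivial)
  · exact Or.inl (zGen_mem_aSubgroup _)

lemma eq_one_or_zGen_of_map_eq_one
    (hn : 1 ≤ n) (hθs : ∀ i : Fin (n - 1), θ (sGen i) =
      SemidirectProduct.inr (Equiv.swap (idx1 i) (idx2 i)))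
    (hθa : ∀ j, θ (aGen j) =
      SemidirectProduct.inl (Pi.mulSingle j (Multiplicative.ofAdd (1 : ZMod 2))))
    (hθz : θ (zGen n) = 1) {g : HTilde n} (h1 : θ g = 1) : g = 1 ∨ g = zGen n := by
  have hp {i : ℕ} (hi : i ≤ n - 1) : i % n = i := Nat.mod_eq_of_lt (by omega)
  refine eq_one_or_zGen_of_mem_aSubgroup hθa hθz
    (mem_of_perm_eq_one (s := sSeq n) (N := aSubgroup Set.univ)
      (p := fun i => (⟨i % n, Nat.mod_lt _ hn⟩ : Fin n))
      (φ := SemidirectProduct.rightHom.comp θ) ?_ (n - 1) ?_ ?_ ?_ ?_ ?_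
      (mem_closure_aSubgroup_sSeq g) (by simp [h1])) h1
  · intro x hx
    obtain ⟨v, hv, -⟩ := exists_inl_of_mem_aSubgroup hθa hθz hx
    simp [hv]
  · intro i hi j hj hij
    rw [Fin.mk.injEq, hp hi, hp hj] at hij
    exact hij
  · intro i hi
    rw [sSeq_of_lt hi, sGen_mul_self]
  · intro i hi
    rw [sSeq_of_lt hi, sSeq_of_lt (i.lt_succ_self.trans hi)]
    exact sGen_braid rfl
  · intro i j hij hj
    rw [sSeq_of_lt hj, sSeq_of_lt (show i < n - 1 by omega)]
    exact sGen_comm hij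
  · intro i hi
    simp only [MonoidHom.comp_apply, sSeq_of_lt hi, hθs, SemidirectProduct.rightHom_inr,
      hp (Nat.succ_le_of_lt hi), hp hi.le]
    rfl

end Kernel

section Surjective

variable {θ : HTilde n →* HOcta n}

lemma closure_range_swap_idx (n : ℕ) :
    Subgroup.closure (Set.range fun i : Fin (n - 1) => Equiv.swap (idx1 i) (idx2 i)) = ⊤ := by
  obtain _ | n := n
  · exact Subsingleton.elim _ _
  · have h := Equiv.Perm.mclosure_swap_castSucc_succ n
    exact Subgroup.closure_eq_top_of_mclosure_eq_top h

lemma surjective_of_map_generators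
    (hθs : ∀ i : Fin (n - 1), θ (sGen i) =
      SemidirectProduct.inr (Equiv.swap (idx1 i) (idx2 i)))
    (hθa : ∀ j, θ (aGen j) =
      SemidirectProduct.inl (Pi.mulSingle j (Multiplicative.ofAdd (1 : ZMod 2)))) :
    Function.Surjective θ := by
  have hr (σ : Equiv.Perm (Fin n)) : (SemidirectProduct.inr σ : HOcta n) ∈ θ.range := by
    have hle : (⊤ : Subgroup (Equiv.Perm (Fin n))) ≤ θ.range.comap SemidirectProduct.inr := by
      rw [← closure_range_swap_idx, Subgroup.closure_le]
      rintro _ ⟨i, rfl⟩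
      exact ⟨_, hθs i⟩
    exact hle (Subgroup.mem_top σ)
  have hl (v : Fin n → Multiplicative (ZMod 2)) :
      (SemidirectProduct.inl v : HOcta n) ∈ θ.range := by
    change v ∈ θ.range.comap SemidirectProduct.inl
    rw [← Finset.univ_prod_mulSingle v]
    refine prod_mem fun j _ => ?_
    obtain h | h : v j = 1 ∨ v j = Multiplicative.ofAdd (1 : ZMod 2) := by
      generalize v j = x
      revert x
      decide
    · rw [h, Pi.mulSingle_one]
      exact one_mem _
    · rw [h]
      exact ⟨_, hθa j⟩
  intro x
  rw [← SemidirectProduct.inl_left_mul_inr_right x]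
  exact mul_mem (hl _) (hr _)

end Surjective

lemma zGen_ne_one : zGen n ≠ 1 := by
  obtain ⟨f, -, -, hf⟩ := exists_hom_semidirectProduct (n := n) permCliffordUnits cliffordUnit (-1)
    permCliffordUnits_cliffordUnit (fun σ => Units.ext (by simp [permCliffordUnits]))
    (by simp) (by simp) cliffordUnit_mul_self fun _ _ => cliffordUnit_anticomm
  intro h
  change f (zGen n) = _ at hf
  rw [h, map_one, eq_comm, ← map_one SemidirectProduct.inl,
    SemidirectProduct.inl_injective.eq_iff] at hf
  exact neg_one_ne_one_cliffordUnits hf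

lemma permAut_mulSingle {M : Type*} [Group M] (σ : Equiv.Perm (Fin n)) (j : Fin n) (x : M) :
    permAut n M σ (Pi.mulSingle j x) = Pi.mulSingle (σ j) x := by
  ext i
  change (Pi.mulSingle j x : Fin n → M) (σ.symm i) = _
  simp [Pi.mulSingle_apply, Equiv.symm_apply_eq]

theorem exists_theta (n : ℕ) (hn : 1 ≤ n) :
    ∃ θ : HTilde n →* HOcta n,
      (∀ i : Fin (n - 1), θ (PresentedGroup.of (HGen.s i)) =
          SemidirectProduct.inr (Equiv.swap (idx1 i) (idx2 i))) ∧
      (∀ j : Fin n, θ (PresentedGroup.of (HGen.a j)) =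
          SemidirectProduct.inl (Pi.mulSingle j (Multiplicative.ofAdd (1 : ZMod 2)))) ∧
      θ (PresentedGroup.of (HGen.z)) = 1 ∧
      Function.Surjective θ ∧
      (θ.ker : Set (HTilde n)) = {1, PresentedGroup.of (HGen.z)} ∧
      (PresentedGroup.of (HGen.z) : HTilde n) ∈ Subgroup.center (HTilde n) ∧
      (PresentedGroup.of (HGen.z) : HTilde n) ≠ 1 := by
  obtain ⟨θ, hs, ha, hz⟩ := exists_hom_semidirectProduct (permAut n (Multiplicative (ZMod 2)))
    (fun j => Pi.mulSingle j (Multiplicative.ofAdd (1 : ZMod 2))) 1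
    (fun σ j => permAut_mulSingle σ j _) (fun σ => map_one _) (one_pow 2)
    (fun j => by rw [one_mul, mul_one])
    (fun j => by rw [← Pi.mulSingle_mul, show Multiplicative.ofAdd (1 : ZMod 2) *
      Multiplicative.ofAdd 1 = 1 by decide, Pi.mulSingle_one])
    (fun i j _ => by rw [one_mul, mul_comm])
  rw [map_one] at hz
  refine ⟨θ, hs, ha, hz, surjective_of_map_generators hs ha, ?_, zGen_mem_center, zGen_ne_one⟩
  ext g
  constructor
  · exact fun hg => eq_one_or_zGen_of_map_eq_one hn hs ha hz hg
  · rintro (rfl | rfl)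
    · exact one_mem _
    · exact hz

end SpinHyperoctahedral
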